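/- Let n and m be unit vectors in a real inner product space E, P := id − n⊗n, Q := id − m⊗m, let H : E → E be a self-adjoint continuous linear map with H n = 0, let d ∈ ℝ, set A := id − d·H, B := Q ∘ A ∘ P, and let B* := P ∘ A ∘ Q be the adjoint of B. Then P − B* ∘ B = 2d·H − d²·(H ∘ H) + (P m − d·H m)⊗(P m − d·H m), and consequently, in operator norm, ‖P − B* ∘ B‖ ≤ 2|d|·‖H‖ + d²·‖H‖² + (‖P m‖ + |d|·‖H‖)². -/

import Mathlib

open scoped RealInnerProductSpace
open ContinuousLinearMap

/-- The rank-one operator `(u ⊗ w) v = ⟨w, v⟩ u`. -/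
noncomputable def rankOne {E : Type*} [NormedAddCommGroup E] [InnerProductSpace ℝ E]
    (u w : E) : E →L[ℝ] E :=
  (innerSL ℝ w).smulRight u

/-- The orthogonal projection `id - u ⊗ u` onto `{u}ᗮ` (for `u` a unit vector). -/
noncomputable def projPerp {E : Type*} [NormedAddCommGroup E] [InnerProductSpace ℝ E]
    (u : E) : E →L[ℝ] E :=
  ContinuousLinearMap.id ℝ E - rankOne u u

lemma rankOne_apply {E : Type*} [NormedAddCommGroup E] [InnerProductSpace ℝ E] (u w v : E) :
    rankOne u w v = ⟪w, v⟫ • u := by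
  simp [rankOne]

lemma projPerp_apply {E : Type*} [NormedAddCommGroup E] [InnerProductSpace ℝ E] (u v : E) :
    projPerp u v = v - ⟪u, v⟫ • u := by
  simp [projPerp, rankOne_apply]

lemma norm_rankOne {E : Type*} [NormedAddCommGroup E] [InnerProductSpace ℝ E] (u w : E) :
    ‖rankOne u w‖ = ‖w‖ * ‖u‖ := by
  simp [rankOne, norm_smulRight_apply]

lemma inner_projPerp_left {E : Type*} [NormedAddCommGroup E] [InnerProductSpace ℝ E]
    (u x y : E) : ⟪projPerp u x, y⟫ = ⟪x, projPerp u y⟫ := by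
  simp only [projPerp_apply, inner_sub_left, inner_sub_right, real_inner_smul_left,
    real_inner_smul_right, real_inner_comm u x]
  ring

lemma projPerp_projPerp {E : Type*} [NormedAddCommGroup E] [InnerProductSpace ℝ E]
    {u : E} (hu : ‖u‖ = 1) (v : E) : projPerp u (projPerp u v) = projPerp u v := by
  simp [projPerp_apply, inner_sub_right, real_inner_smul_right, hu]

lemma map_projPerp_of_map_eq_zero {E : Type*} [NormedAddCommGroup E] [InnerProductSpace ℝ E]
    {u : E} {H : E →L[ℝ] E} (hu : H u = 0) (v : E) : H (projPerp u v) = H v := by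
  simp [projPerp_apply, hu]

lemma projPerp_map_of_map_eq_zero {E : Type*} [NormedAddCommGroup E] [InnerProductSpace ℝ E]
    {u : E} {H : E →L[ℝ] E} (hH : ∀ x y : E, ⟪H x, y⟫ = ⟪x, H y⟫) (hu : H u = 0) (v : E) :
    projPerp u (H v) = H v := by
  simp [projPerp_apply, ← hH, hu]

/-- with `P = id - n⊗n`, `Q = id - m⊗m`, `H` self-adjoint with `H n = 0`,
`A = id - d•H`, `B = Q ∘ A ∘ P` and its adjoint `B* = P ∘ A ∘ Q`, one has
`P - B* ∘ B = 2d•H - d²•(H ∘ H) + (P m - d•H m)⊗(P m - d•H m)` and consequently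
`‖P - B* ∘ B‖ ≤ 2|d|‖H‖ + d²‖H‖² + (‖P m‖ + |d|‖H‖)²`. -/
theorem tangential_gradient_map_second_estimate
    {E : Type*} [NormedAddCommGroup E] [InnerProductSpace ℝ E]
    (n m : E) (hn : ‖n‖ = 1) (hm : ‖m‖ = 1)
    (H : E →L[ℝ] E) (hH_sa : ∀ x y : E, ⟪H x, y⟫ = ⟪x, H y⟫) (hHn : H n = 0)
    (d : ℝ)
    (P Q A B Bstar : E →L[ℝ] E)
    (hP : P = projPerp n) (hQ : Q = projPerp m)
    (hA : A = ContinuousLinearMap.id ℝ E - d • H)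
    (hB : B = Q ∘L A ∘L P)
    (hBstar : Bstar = P ∘L A ∘L Q) :
    P - Bstar ∘L B
        = (2 * d) • H - (d ^ 2) • (H ∘L H)
          + rankOne (P m - d • H m) (P m - d • H m) ∧
    ‖P - Bstar ∘L B‖ ≤ 2 * |d| * ‖H‖ + d ^ 2 * ‖H‖ ^ 2 + (‖P m‖ + |d| * ‖H‖) ^ 2 := by
  have hw : ∀ v, ⟪m, A (P v)⟫ = ⟪P m - d • H m, v⟫ := fun v => by
    simp [hA, hP, inner_sub_left, inner_sub_right, real_inner_smul_left, real_inner_smul_right,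
      map_projPerp_of_map_eq_zero hHn, inner_projPerp_left, hH_sa]
  have key : P - Bstar ∘L B
      = (2 * d) • H - (d ^ 2) • (H ∘L H)
        + rankOne (P m - d • H m) (P m - d • H m) := by
    ext v
    have hQQ : Q (Q (A (P v))) = A (P v) - ⟪P m - d • H m, v⟫ • m := by
      rw [hQ, projPerp_projPerp hm, projPerp_apply, hw]
    simp only [hB, hBstar, sub_apply, add_apply, coe_comp, Function.comp_apply, smul_apply,
      rankOne_apply, hQQ]
    simp only [hA, hP, sub_apply, smul_apply, id_apply, map_sub, map_smul,
      projPerp_projPerp hn, map_projPerp_of_map_eq_zero hHn,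
      projPerp_map_of_map_eq_zero hH_sa hHn]
    module
  refine ⟨key, key ▸ ?_⟩
  have hvec : ‖P m - d • H m‖ ≤ ‖P m‖ + |d| * ‖H‖ :=
    calc ‖P m - d • H m‖ ≤ ‖P m‖ + ‖d • H m‖ := norm_sub_le _ _
      _ = ‖P m‖ + |d| * ‖H m‖ := by rw [norm_smul, Real.norm_eq_abs]
      _ ≤ ‖P m‖ + |d| * ‖H‖ := by
        gcongr
        simpa [hm] using H.le_opNorm m
  calc ‖(2 * d) • H - (d ^ 2) • (H ∘L H) + rankOne (P m - d • H m) (P m - d • H m)‖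
      ≤ ‖(2 * d) • H‖ + ‖(d ^ 2) • (H ∘L H)‖ + ‖rankOne (P m - d • H m) (P m - d • H m)‖ :=
        (norm_add_le _ _).trans (by gcongr; exact norm_sub_le _ _)
    _ = 2 * |d| * ‖H‖ + d ^ 2 * ‖H ∘L H‖ + ‖P m - d • H m‖ ^ 2 := by
        simp [norm_smul, norm_rankOne, sq]
    _ ≤ 2 * |d| * ‖H‖ + d ^ 2 * ‖H‖ ^ 2 + (‖P m‖ + |d| * ‖H‖) ^ 2 := by
        gcongr
        simpa only [sq] using H.opNorm_comp_le H
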